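/- There exists a constant C > 0 depending only on m, k, γ such that for every (z,t) with z ≠ 0: |X_iX_jρ| ≤ C ψ/ρ whenever 1 ≤ i, j ≤ m or m+1 ≤ i, j ≤ N; |X_iX_{m+j}ρ| ≤ C ψ^{1/2}/|z| = C ψ^{1/2 − 1/(2γ)}/ρ for 1 ≤ i ≤ m and 1 ≤ j ≤ k; and |X_{m+j}X_iρ| ≤ C ψ^{3/2}|z|/ρ² = C ψ^{3/2 + 1/(2γ)}/ρ for 1 ≤ i ≤ m and 1 ≤ j ≤ k. -/

import Mathlib

open MeasureTheory Real Set Filter Asymptotics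

noncomputable section

/-- The underlying space ℝ^m × ℝ^k. -/
abbrev E (m k : ℕ) : Type :=
  EuclideanSpace ℝ (Fin m) × EuclideanSpace ℝ (Fin k)

namespace BG

variable {m k : ℕ}

/-- The Baouendi–Grushin gauge ρ. -/
def rho (γ : ℝ) (p : E m k) : ℝ :=
  (‖p.1‖ ^ (2 * (γ + 1)) + (γ + 1) ^ 2 * ‖p.2‖ ^ 2) ^ (1 / (2 * (γ + 1)))

/-- The angle function ψ = |z|^{2γ}/ρ^{2γ}. -/
def psi (γ : ℝ) (p : E m k) : ℝ :=
  ‖p.1‖ ^ (2 * γ) / rho γ p ^ (2 * γ)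

/-- The gauge ball B_r = {ρ < r}. -/
def ball (γ r : ℝ) : Set (E m k) := {p | rho γ p < r}

/-- The Baouendi–Grushin vector fields as direction fields:
X_i = ∂_{z_i} for i < m, X_{m+j} = |z|^γ ∂_{t_j}. -/
def Xvec (γ : ℝ) (p : E m k) (i : Fin (m + k)) : E m k :=
  if h : (i : ℕ) < m then (EuclideanSpace.single ⟨(i : ℕ), h⟩ 1, 0)
  else (0, EuclideanSpace.single ⟨(i : ℕ) - m, by have := i.isLt; omega⟩ (‖p.1‖ ^ γ))

/-- Derivative along the i-th Baouendi–Grushin vector field. -/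
def Xd (γ : ℝ) (i : Fin (m + k)) (f : E m k → ℝ) (p : E m k) : ℝ :=
  fderiv ℝ f p (Xvec γ p i)

/-- The quadratic form ⟨A Xu, Xu⟩. -/
def quadA (γ : ℝ) (A : E m k → Matrix (Fin (m + k)) (Fin (m + k)) ℝ)
    (u : E m k → ℝ) (p : E m k) : ℝ :=
  ∑ i, ∑ j, A p i j * Xd γ i u p * Xd γ j u p

/-- μ = ⟨A Xρ, Xρ⟩. -/
def mu (γ : ℝ) (A : E m k → Matrix (Fin (m + k)) (Fin (m + k)) ℝ) (p : E m k) : ℝ :=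
  quadA γ A (rho γ) p

/-- The operator 𝓛 u = Σ_{i,j} X_i(a_{ij} X_j u). -/
def Lop (γ : ℝ) (A : E m k → Matrix (Fin (m + k)) (Fin (m + k)) ℝ)
    (u : E m k → ℝ) (p : E m k) : ℝ :=
  ∑ i, ∑ j, Xd γ i (fun q => A q i j * Xd γ j u q) p

/-- The vector field F = (ρ/μ) Σ a_{ij} X_iρ X_j, as a first order operator. -/
def Fop (γ : ℝ) (A : E m k → Matrix (Fin (m + k)) (Fin (m + k)) ℝ)
    (v : E m k → ℝ) (p : E m k) : ℝ :=
  rho γ p / mu γ A p * ∑ i, ∑ j, A p i j * Xd γ i (rho γ) p * Xd γ j v p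

/-- The Baouendi–Grushin operator 𝓑_γ = Δ_z + |z|^{2γ} Δ_t = Σ_i X_i X_i. -/
def Bop (γ : ℝ) (u : E m k → ℝ) (p : E m k) : ℝ :=
  ∑ i : Fin (m + k), Xd γ i (Xd γ i u) p

/-- The generator of anisotropic dilations Z = Σ z_i ∂_{z_i} + (γ+1) Σ t_j ∂_{t_j},
as a first order operator: the derivative in the direction (z, (γ+1) t). -/
def Zd (γ : ℝ) (v : E m k → ℝ) (p : E m k) : ℝ :=
  fderiv ℝ v p (p.1, (γ + 1) • p.2)

/-- The Euclidean divergence of a vector field on ℝ^m × ℝ^k. -/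
def divV (V : E m k → E m k) (p : E m k) : ℝ :=
  (∑ i : Fin m, (fderiv ℝ V p (EuclideanSpace.single i 1, 0)).1 i) +
    ∑ j : Fin k,
      (fderiv ℝ V p ((0 : EuclideanSpace ℝ (Fin m)), EuclideanSpace.single j 1)).2 j

/-- Uniform ellipticity: λ|η|² ≤ ⟨Aη,η⟩ ≤ λ⁻¹|η|². -/
def Elliptic (lam : ℝ) (A : E m k → Matrix (Fin (m + k)) (Fin (m + k)) ℝ) : Prop :=
  ∀ (p : E m k) (η : Fin (m + k) → ℝ),
    lam * ∑ i, η i ^ 2 ≤ ∑ i, ∑ j, A p i j * η i * η j ∧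
      ∑ i, ∑ j, A p i j * η i * η j ≤ lam⁻¹ * ∑ i, η i ^ 2

/-- Symmetry of the matrix A. -/
def Symm (A : E m k → Matrix (Fin (m + k)) (Fin (m + k)) ℝ) : Prop :=
  ∀ p i j, A p i j = A p j i

/-- The entries of A are C¹. -/
def C1coeff (A : E m k → Matrix (Fin (m + k)) (Fin (m + k)) ℝ) : Prop :=
  ∀ i j, ContDiff ℝ 1 fun p => A p i j

/-- The structural hypothesis (H) on B = A - I, in B_1. -/
def HypH (γ Λ : ℝ) (A : E m k → Matrix (Fin (m + k)) (Fin (m + k)) ℝ) : Prop :=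
  ∀ p ∈ ball (m := m) (k := k) γ 1,
    (∀ i j : Fin (m + k),
        |(A p - 1) i j| ≤
          if (i : ℕ) < m ∧ (j : ℕ) < m then Λ * rho γ p
          else Λ * psi γ p ^ ((1 : ℝ) / 2 + 1 / (2 * γ)) * rho γ p) ∧
      ∀ l i j : Fin (m + k),
        |Xd γ l (fun q => (A q - 1) i j) p| ≤
          if (l : ℕ) < m ∧ (i : ℕ) < m ∧ (j : ℕ) < m then Λ
          else if m ≤ (l : ℕ) ∧ (m ≤ (i : ℕ) ∨ m ≤ (j : ℕ)) then
            Λ * psi γ p ^ ((1 : ℝ) + 1 / (2 * γ))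
          else Λ * psi γ p ^ ((1 : ℝ) / 2)

end BG

namespace BG

lemma euclid_coord_le {n : ℕ} (x : EuclideanSpace ℝ (Fin n)) (i : Fin n) : |x i| ≤ ‖x‖ := by
  simpa using PiLp.norm_apply_le x i

/-- derivative of `|z|^α` at `z ≠ 0`. -/
lemma hasFDerivAt_normz {m k : ℕ} (α : ℝ) (p : E m k) (hp : p.1 ≠ 0) :
    HasFDerivAt (fun q : E m k => ‖q.1‖ ^ α)
      ((α * ‖p.1‖ ^ (α - 2)) • (innerSL ℝ p.1).comp
        (ContinuousLinearMap.fst ℝ (EuclideanSpace ℝ (Fin m)) (EuclideanSpace ℝ (Fin k)))) p := by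
  have hs : 0 < ‖p.1‖ := norm_pos_iff.mpr hp
  have h1 : HasFDerivAt (fun q : E m k => ‖q.1‖ ^ 2)
      ((2 : ℝ) • (innerSL ℝ p.1).comp
        (ContinuousLinearMap.fst ℝ (EuclideanSpace ℝ (Fin m)) (EuclideanSpace ℝ (Fin k)))) p := by
    have h := (hasStrictFDerivAt_norm_sq p.1).hasFDerivAt.comp p (hasFDerivAt_fst (𝕜 := ℝ) (p := p))
    refine h.congr_fderiv ?_
    ext <;> simp [two_smul, two_mul]
  have h2 := h1.rpow_const (p := α / 2) (Or.inl (by positivity))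
  have e : ∀ (x : ℝ) (β : ℝ), 0 ≤ x → (x ^ 2) ^ β = x ^ (2 * β) := by
    intro x β hx
    rw [← Real.rpow_natCast, ← Real.rpow_mul hx]; norm_num
  have hf : (fun q : E m k => ‖q.1‖ ^ α) = fun q : E m k => (‖q.1‖ ^ 2) ^ (α / 2) := by
    funext q
    rw [e _ _ (norm_nonneg _)]; congr 1; ring
  rw [hf]
  refine h2.congr_fderiv ?_
  rw [e _ _ (norm_nonneg _), smul_smul]
  congr 1
  rw [show 2 * (α / 2 - 1) = α - 2 by ring]; ring

lemma hasFDerivAt_normt {m k : ℕ} (p : E m k) :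
    HasFDerivAt (fun q : E m k => ‖q.2‖ ^ 2)
      ((2 : ℝ) • (innerSL ℝ p.2).comp
        (ContinuousLinearMap.snd ℝ (EuclideanSpace ℝ (Fin m)) (EuclideanSpace ℝ (Fin k)))) p := by
  have h := (hasStrictFDerivAt_norm_sq p.2).hasFDerivAt.comp p (hasFDerivAt_snd (𝕜 := ℝ) (p := p))
  refine h.congr_fderiv ?_
  ext <;> simp [two_smul, two_mul]

lemma rho_pos {m k : ℕ} {γ : ℝ} (hγ : 0 < γ) (p : E m k) (hp : p.1 ≠ 0) : 0 < rho γ p := by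
  have hs : 0 < ‖p.1‖ := norm_pos_iff.mpr hp
  unfold rho; positivity

lemma rho_rpow {m k : ℕ} {γ : ℝ} (hγ : 0 < γ) (p : E m k) :
    rho γ p ^ (2 * (γ + 1)) = ‖p.1‖ ^ (2 * (γ + 1)) + (γ + 1) ^ 2 * ‖p.2‖ ^ 2 := by
  unfold rho
  rw [← Real.rpow_mul (by positivity), one_div_mul_cancel (by positivity), Real.rpow_one]

lemma normz_le_rho {m k : ℕ} {γ : ℝ} (hγ : 0 < γ) (p : E m k) (hp : p.1 ≠ 0) :
    ‖p.1‖ ≤ rho γ p := by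
  have h := rho_rpow hγ p
  have h2 : 0 ≤ (γ + 1) ^ 2 * ‖p.2‖ ^ 2 := by positivity
  exact (Real.rpow_le_rpow_iff (norm_nonneg _) (rho_pos hγ p hp).le
    (show 0 < 2 * (γ + 1) by positivity)).1 (by linarith)

lemma normt_le_rho {m k : ℕ} {γ : ℝ} (hγ : 0 < γ) (p : E m k) (hp : p.1 ≠ 0) :
    (γ + 1) * ‖p.2‖ ≤ rho γ p ^ (γ + 1) := by
  have h := rho_rpow hγ p
  have h2 : 0 ≤ ‖p.1‖ ^ (2 * (γ + 1)) := by positivity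
  have hr := rho_pos hγ p hp
  rw [show 2 * (γ + 1) = (γ + 1) + (γ + 1) by ring, Real.rpow_add hr] at h
  rw [show 2 * (γ + 1) = (γ + 1) + (γ + 1) by ring] at h2
  refine abs_le_of_sq_le_sq' ?_ (by positivity) |>.2
  nlinarith

/-- the derivative of a power of the gauge. -/
lemma hasFDerivAt_rho_rpow {m k : ℕ} {γ : ℝ} (hγ : 0 < γ) (β : ℝ) (p : E m k) (hp : p.1 ≠ 0) :
    HasFDerivAt (fun q : E m k => rho γ q ^ β)
      ((β * rho γ p ^ (β - 2 * γ - 2)) • (‖p.1‖ ^ (2 * γ) • (innerSL ℝ p.1).comp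
        (ContinuousLinearMap.fst ℝ (EuclideanSpace ℝ (Fin m)) (EuclideanSpace ℝ (Fin k))) +
        (γ + 1) • (innerSL ℝ p.2).comp
        (ContinuousLinearMap.snd ℝ (EuclideanSpace ℝ (Fin m)) (EuclideanSpace ℝ (Fin k))))) p := by
  have hs : 0 < ‖p.1‖ := norm_pos_iff.mpr hp
  have h1 := (hasFDerivAt_normz (2 * (γ + 1)) p hp).add
    ((hasFDerivAt_normt p).const_mul ((γ + 1) ^ 2))
  have h2 := h1.rpow_const (p := β / (2 * (γ + 1))) (Or.inl (by
    have : 0 < ‖p.1‖ ^ (2 * (γ + 1)) := by positivity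
    have : 0 ≤ (γ + 1) ^ 2 * ‖p.2‖ ^ 2 := by positivity
    simp only [Pi.add_apply]
    positivity))
  have hf : (fun q : E m k => rho γ q ^ β) = fun q : E m k =>
      (‖q.1‖ ^ (2 * (γ + 1)) + (γ + 1) ^ 2 * ‖q.2‖ ^ 2) ^ (β / (2 * (γ + 1))) := by
    funext q
    rw [← rho_rpow hγ, ← Real.rpow_mul]
    · congr 1; field_simp
    · unfold rho; positivity
  rw [hf]
  refine h2.congr_fderiv ?_
  simp only [Pi.add_apply]
  rw [← rho_rpow hγ, ← Real.rpow_mul (rho_pos hγ p hp).le,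
    show 2 * (γ + 1) * (β / (2 * (γ + 1)) - 1) = β - 2 * γ - 2 by field_simp; ring,
    show 2 * (γ + 1) - 2 = 2 * γ by ring]
  simp only [smul_add, smul_smul]
  congr 2 <;> field_simp

/-- The z-derivatives of the gauge. -/
lemma Xd_z {m k : ℕ} (γ : ℝ) (f : E m k → ℝ) (p : E m k) (i : Fin m) :
    Xd γ (Fin.castAdd k i) f p = fderiv ℝ f p (EuclideanSpace.single i 1, 0) := by
  simp [Xd, Xvec]

lemma Xd_t {m k : ℕ} (γ : ℝ) (f : E m k → ℝ) (p : E m k) (j : Fin k) :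
    Xd γ (Fin.natAdd m j) f p = fderiv ℝ f p (0, EuclideanSpace.single j (‖p.1‖ ^ γ)) := by
  simp [Xd, Xvec]

lemma hasFDerivAt_rho {m k : ℕ} {γ : ℝ} (hγ : 0 < γ) (p : E m k) (hp : p.1 ≠ 0) :
    HasFDerivAt (fun q : E m k => rho γ q)
      ((rho γ p ^ (-2 * γ - 1)) • (‖p.1‖ ^ (2 * γ) • (innerSL ℝ p.1).comp
        (ContinuousLinearMap.fst ℝ (EuclideanSpace ℝ (Fin m)) (EuclideanSpace ℝ (Fin k))) +
        (γ + 1) • (innerSL ℝ p.2).comp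
        (ContinuousLinearMap.snd ℝ (EuclideanSpace ℝ (Fin m)) (EuclideanSpace ℝ (Fin k))))) p := by
  have h := hasFDerivAt_rho_rpow hγ 1 p hp
  simp only [Real.rpow_one, one_mul] at h
  rwa [show 1 - 2 * γ - 2 = -2 * γ - 1 by ring] at h

lemma Xd_z_rho {m k : ℕ} {γ : ℝ} (hγ : 0 < γ) (p : E m k) (hp : p.1 ≠ 0) (i : Fin m) :
    Xd γ (Fin.castAdd k i) (rho γ) p = rho γ p ^ (-2 * γ - 1) * (‖p.1‖ ^ (2 * γ) * p.1 i) := by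
  rw [Xd_z, (hasFDerivAt_rho hγ p hp).fderiv]
  simp [EuclideanSpace.inner_single_right]

lemma Xd_t_rho {m k : ℕ} {γ : ℝ} (hγ : 0 < γ) (p : E m k) (hp : p.1 ≠ 0) (j : Fin k) :
    Xd γ (Fin.natAdd m j) (rho γ) p
      = rho γ p ^ (-2 * γ - 1) * (‖p.1‖ ^ γ * ((γ + 1) * p.2 j)) := by
  rw [Xd_t, (hasFDerivAt_rho hγ p hp).fderiv]
  simp [EuclideanSpace.inner_single_right]
  left; ring

lemma eventually_z {m k : ℕ} (p : E m k) (hp : p.1 ≠ 0) :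
    ∀ᶠ q : E m k in nhds p, q.1 ≠ 0 :=
  (continuous_fst.continuousAt (x := p)).eventually_ne hp

lemma hasFDerivAt_z {m k : ℕ} (p : E m k) (i : Fin m) :
    HasFDerivAt (fun q : E m k => q.1 i)
      ((EuclideanSpace.proj (𝕜 := ℝ) i).comp
        (ContinuousLinearMap.fst ℝ (EuclideanSpace ℝ (Fin m)) (EuclideanSpace ℝ (Fin k)))) p :=
  ContinuousLinearMap.hasFDerivAt ((EuclideanSpace.proj (𝕜 := ℝ) i).comp
        (ContinuousLinearMap.fst ℝ (EuclideanSpace ℝ (Fin m)) (EuclideanSpace ℝ (Fin k))))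

lemma hasFDerivAt_t {m k : ℕ} (p : E m k) (i : Fin k) :
    HasFDerivAt (fun q : E m k => q.2 i)
      ((EuclideanSpace.proj (𝕜 := ℝ) i).comp
        (ContinuousLinearMap.snd ℝ (EuclideanSpace ℝ (Fin m)) (EuclideanSpace ℝ (Fin k)))) p :=
  ContinuousLinearMap.hasFDerivAt ((EuclideanSpace.proj (𝕜 := ℝ) i).comp
        (ContinuousLinearMap.snd ℝ (EuclideanSpace ℝ (Fin m)) (EuclideanSpace ℝ (Fin k))))

lemma fderiv_Xd_z {m k : ℕ} {γ : ℝ} (hγ : 0 < γ) (p : E m k) (hp : p.1 ≠ 0) (i : Fin m)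
    (v : E m k) :
    fderiv ℝ (Xd γ (Fin.castAdd k i) (rho γ)) p v =
      rho γ p ^ (-2 * γ - 1) * (‖p.1‖ ^ (2 * γ) * v.1 i
        + p.1 i * (2 * γ * ‖p.1‖ ^ (2 * γ - 2) * inner ℝ p.1 v.1))
      + ‖p.1‖ ^ (2 * γ) * p.1 i * ((-2 * γ - 1) * rho γ p ^ (-4 * γ - 3) *
        (‖p.1‖ ^ (2 * γ) * inner ℝ p.1 v.1 + (γ + 1) * inner ℝ p.2 v.2)) := by
  have he : (Xd γ (Fin.castAdd k i) (rho γ)) =ᶠ[nhds p]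
      fun q : E m k => rho γ q ^ (-2 * γ - 1) * (‖q.1‖ ^ (2 * γ) * q.1 i) := by
    filter_upwards [eventually_z p hp] with q hq
    exact Xd_z_rho hγ q hq i
  have h := (hasFDerivAt_rho_rpow hγ (-2 * γ - 1) p hp).mul
    ((hasFDerivAt_normz (2 * γ) p hp).mul (hasFDerivAt_z p i))
  rw [he.fderiv_eq]
  erw [h.fderiv]
  rw [show -2 * γ - 1 - 2 * γ - 2 = -4 * γ - 3 by ring]
  simp
  ring

lemma fderiv_Xd_t {m k : ℕ} {γ : ℝ} (hγ : 0 < γ) (p : E m k) (hp : p.1 ≠ 0) (j : Fin k)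
    (v : E m k) :
    fderiv ℝ (Xd γ (Fin.natAdd m j) (rho γ)) p v =
      rho γ p ^ (-2 * γ - 1) * (‖p.1‖ ^ γ * ((γ + 1) * v.2 j)
        + (γ + 1) * p.2 j * (γ * ‖p.1‖ ^ (γ - 2) * inner ℝ p.1 v.1))
      + ‖p.1‖ ^ γ * ((γ + 1) * p.2 j) * ((-2 * γ - 1) * rho γ p ^ (-4 * γ - 3) *
        (‖p.1‖ ^ (2 * γ) * inner ℝ p.1 v.1 + (γ + 1) * inner ℝ p.2 v.2)) := by
  have he : (Xd γ (Fin.natAdd m j) (rho γ)) =ᶠ[nhds p]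
      fun q : E m k => rho γ q ^ (-2 * γ - 1) * (‖q.1‖ ^ γ * ((γ + 1) * q.2 j)) := by
    filter_upwards [eventually_z p hp] with q hq
    exact Xd_t_rho hγ q hq j
  have h := (hasFDerivAt_rho_rpow hγ (-2 * γ - 1) p hp).mul
    ((hasFDerivAt_normz γ p hp).mul ((hasFDerivAt_t p j).const_mul (γ + 1)))
  rw [he.fderiv_eq]
  erw [h.fderiv]
  rw [show -2 * γ - 1 - 2 * γ - 2 = -4 * γ - 3 by ring]
  simp
  ring

lemma single_abs_le {n : ℕ} (i j : Fin n) :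
    |(EuclideanSpace.single i (1 : ℝ) : EuclideanSpace ℝ (Fin n)) j| ≤ 1 := by
  by_cases h : j = i <;> simp [h]

/-- Bound zz. -/
lemma bound_zz {m k : ℕ} {γ : ℝ} (hγ : 0 < γ) (p : E m k) (hp : p.1 ≠ 0) (i j : Fin m) :
    |Xd γ (Fin.castAdd k i) (Xd γ (Fin.castAdd k j) (rho γ)) p|
      ≤ (4 * (γ + 1) ^ 2) * psi γ p / rho γ p := by
  rw [Xd_z, fderiv_Xd_z hγ p hp]
  have hs : 0 < ‖p.1‖ := norm_pos_iff.mpr hp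
  have hr := rho_pos hγ p hp
  have hsr := normz_le_rho hγ p hp
  have hi := euclid_coord_le p.1 i
  have hj := euclid_coord_le p.1 j
  have hd := single_abs_le i j
  simp only [EuclideanSpace.inner_single_right, inner_zero_right, map_one, one_mul, mul_zero,
    add_zero, psi, conj_trivial]
  set d := (EuclideanSpace.single i (1 : ℝ) : EuclideanSpace ℝ (Fin m)) j
  set s := ‖p.1‖
  set r := rho γ p
  set x := p.1 i
  set y := p.1 j
  have e1 : s ^ (2 * γ - 2) = s ^ (2 * γ) / s ^ 2 := by
    rw [Real.rpow_sub hs]; norm_num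
  have e2 : r ^ (-2 * γ - 1) = 1 / (r ^ (2 * γ) * r) := by
    rw [show -2 * γ - 1 = -(2 * γ + 1) by ring, Real.rpow_neg hr.le, Real.rpow_add hr,
      Real.rpow_one, one_div]
  have e3 : r ^ (-4 * γ - 3) = 1 / (r ^ (2 * γ) * r) * (1 / (r ^ (2 * γ) * r ^ 2)) := by
    rw [show -4 * γ - 3 = -(2 * γ + 2 * γ + 1 + 2) by ring, Real.rpow_neg hr.le,
      Real.rpow_add hr, Real.rpow_add hr, Real.rpow_add hr, Real.rpow_one, Real.rpow_two]
    field_simp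
  have hSR : s ^ (2 * γ) ≤ r ^ (2 * γ) := Real.rpow_le_rpow hs.le hsr (by positivity)
  rw [e1, e2, e3]
  have hS : 0 < s ^ (2 * γ) := by positivity
  have hR : 0 < r ^ (2 * γ) := by positivity
  set S := s ^ (2 * γ)
  set R := r ^ (2 * γ)
  set u := y / s * (x / s) with hu
  have hu1 : |u| ≤ 1 := by
    rw [hu, abs_mul, abs_div, abs_div, abs_of_pos hs]
    exact mul_le_one₀ ((div_le_one hs).2 hj) (by positivity) ((div_le_one hs).2 hi)
  set w := S / R * (s / r) ^ 2 with hw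
  have hw0 : 0 ≤ w := by positivity
  have hw1 : w ≤ 1 := by
    refine mul_le_one₀ ((div_le_one hR).2 hSR) (by positivity) ?_
    exact pow_le_one₀ (by positivity) ((div_le_one hr).2 hsr)
  have key : 1 / (R * r) * (S * d + y * (2 * γ * (S / s ^ 2) * x)) +
      S * y * ((-2 * γ - 1) * (1 / (R * r) * (1 / (R * r ^ 2))) * (S * x))
      = (d + 2 * γ * u - (2 * γ + 1) * (w * u)) * (S / R / r) := by
    rw [hw, hu]; field_simp; ring
  rw [key, abs_mul, abs_of_pos (show 0 < S / R / r by positivity), mul_div_assoc]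
  gcongr
  have hwu : |w * u| ≤ 1 := by
    rw [abs_mul, abs_of_nonneg hw0]; exact mul_le_one₀ hw1 (abs_nonneg _) hu1
  rw [abs_le] at *
  constructor <;> nlinarith

/-- Bound tt. -/
lemma bound_tt {m k : ℕ} {γ : ℝ} (hγ : 0 < γ) (p : E m k) (hp : p.1 ≠ 0) (i j : Fin k) :
    |Xd γ (Fin.natAdd m i) (Xd γ (Fin.natAdd m j) (rho γ)) p|
      ≤ (4 * (γ + 1) ^ 2) * psi γ p / rho γ p := by
  rw [Xd_t, fderiv_Xd_t hγ p hp]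
  have hs : 0 < ‖p.1‖ := norm_pos_iff.mpr hp
  have hr := rho_pos hγ p hp
  have ht := normt_le_rho hγ p hp
  have hi := euclid_coord_le p.2 i
  have hj := euclid_coord_le p.2 j
  have hd := single_abs_le i j
  have hsg : (EuclideanSpace.single i (‖p.1‖ ^ γ) : EuclideanSpace ℝ (Fin k)) j =
    ‖p.1‖ ^ γ * (EuclideanSpace.single i (1 : ℝ) : EuclideanSpace ℝ (Fin k)) j := by
    by_cases h : j = i <;> simp [h]
  rw [hsg]
  simp only [EuclideanSpace.inner_single_right, inner_zero_right, map_one, one_mul, mul_zero,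
    add_zero, zero_add, psi, conj_trivial]
  set d := (EuclideanSpace.single i (1 : ℝ) : EuclideanSpace ℝ (Fin k)) j
  set s := ‖p.1‖
  set r := rho γ p
  set x := p.2 i
  set y := p.2 j
  have e0 : s ^ (2 * γ) = s ^ γ * s ^ γ := by rw [← Real.rpow_add hs]; ring_nf
  have e2 : r ^ (-2 * γ - 1) = 1 / (r ^ (2 * γ) * r) := by
    rw [show -2 * γ - 1 = -(2 * γ + 1) by ring, Real.rpow_neg hr.le, Real.rpow_add hr,
      Real.rpow_one, one_div]
  have e3 : r ^ (-4 * γ - 3) = 1 / (r ^ (2 * γ) * r) * (1 / (r ^ (γ + 1)) ^ 2) := by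
    rw [show -4 * γ - 3 = -(2 * γ + 1 + ((γ + 1) + (γ + 1))) by ring, Real.rpow_neg hr.le,
      Real.rpow_add hr, Real.rpow_add hr (γ + 1), Real.rpow_add hr, Real.rpow_one]
    field_simp
  rw [e0, e2, e3]
  have hS : 0 < s ^ γ := by positivity
  have hR : 0 < r ^ (2 * γ) := by positivity
  have hT : 0 < r ^ (γ + 1) := by positivity
  set S := s ^ γ
  set R := r ^ (2 * γ)
  set T := r ^ (γ + 1)
  set u := ((γ + 1) * y / T) * ((γ + 1) * x / T) with hu
  have hg : 0 < γ + 1 := by positivity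
  have hu1 : |u| ≤ 1 := by
    rw [hu, abs_mul, abs_div, abs_div, abs_of_pos hT, abs_mul, abs_mul, abs_of_pos hg]
    refine mul_le_one₀ ((div_le_one hT).2 ?_) (by positivity) ((div_le_one hT).2 ?_)
    · exact (mul_le_mul_of_nonneg_left hj hg.le).trans ht
    · exact (mul_le_mul_of_nonneg_left hi hg.le).trans ht
  have key : 1 / (R * r) * (S * ((γ + 1) * (S * d))) +
      S * ((γ + 1) * y) * ((-2 * γ - 1) * (1 / (R * r) * (1 / T ^ 2)) * ((γ + 1) * (S * x)))
      = ((γ + 1) * d - (2 * γ + 1) * u) * (S * S / R / r) := by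
    rw [hu]; field_simp; ring
  rw [key, abs_mul, abs_of_pos (show 0 < S * S / R / r by positivity)]
  have hpos : 0 ≤ S * S / R / r := by positivity
  refine (mul_le_mul_of_nonneg_right (b := |(γ + 1) * d - (2 * γ + 1) * u|)
    (c := 4 * (γ + 1) ^ 2) ?_ hpos).trans_eq (by ring)
  rw [abs_le] at *
  constructor <;> nlinarith

/-- Bound zt. -/
lemma bound_zt {m k : ℕ} {γ : ℝ} (hγ : 0 < γ) (p : E m k) (hp : p.1 ≠ 0) (i : Fin m)
    (j : Fin k) :
    |Xd γ (Fin.castAdd k i) (Xd γ (Fin.natAdd m j) (rho γ)) p|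
      ≤ (4 * (γ + 1) ^ 2) * (‖p.1‖ ^ γ / rho γ p ^ γ / ‖p.1‖) := by
  rw [Xd_z, fderiv_Xd_t hγ p hp]
  have hs : 0 < ‖p.1‖ := norm_pos_iff.mpr hp
  have hr := rho_pos hγ p hp
  have hsr := normz_le_rho hγ p hp
  have ht := normt_le_rho hγ p hp
  have hi := euclid_coord_le p.1 i
  have hj := euclid_coord_le p.2 j
  simp only [EuclideanSpace.inner_single_right, inner_zero_right, map_one, one_mul, mul_zero,
    add_zero, zero_add, conj_trivial, PiLp.zero_apply]
  set s := ‖p.1‖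
  set r := rho γ p
  set x := p.1 i
  set y := p.2 j
  have e0 : s ^ (2 * γ) = s ^ γ * s ^ γ := by rw [← Real.rpow_add hs]; ring_nf
  have e1 : s ^ (γ - 2) = s ^ γ / s ^ 2 := by
    rw [Real.rpow_sub hs]; norm_num
  have e2 : r ^ (-2 * γ - 1) = 1 / (r ^ γ * r ^ γ * r) := by
    rw [show -2 * γ - 1 = -(γ + γ + 1) by ring, Real.rpow_neg hr.le, Real.rpow_add hr,
      Real.rpow_add hr, Real.rpow_one, one_div]
  have e3 : r ^ (-4 * γ - 3) = 1 / (r ^ γ * r ^ γ * r) * (1 / (r ^ γ * r) ^ 2) := by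
    rw [show -4 * γ - 3 = -(γ + γ + 1 + ((γ + 1) + (γ + 1))) by ring, Real.rpow_neg hr.le,
      Real.rpow_add hr, Real.rpow_add hr (γ + 1), Real.rpow_add hr, Real.rpow_add hr,
      Real.rpow_one, Real.rpow_add hr, Real.rpow_one]
    field_simp
  have hSR : s ^ γ ≤ r ^ γ := Real.rpow_le_rpow hs.le hsr (by positivity)
  rw [Real.rpow_add hr, Real.rpow_one] at ht
  rw [e0, e1, e2, e3]
  have hS : 0 < s ^ γ := by positivity
  have hR : 0 < r ^ γ := by positivity
  set S := s ^ γ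
  set R := r ^ γ
  have hT : 0 < R * r := by positivity
  set u := ((γ + 1) * y / (R * r)) * (x / s) with hu
  have hg : 0 < γ + 1 := by positivity
  have hu1 : |u| ≤ 1 := by
    rw [hu, abs_mul, abs_div, abs_div, abs_of_pos hT, abs_mul, abs_of_pos hg, abs_of_pos hs]
    refine mul_le_one₀ ((div_le_one hT).2 ?_) (by positivity) ((div_le_one hs).2 hi)
    exact (mul_le_mul_of_nonneg_left hj hg.le).trans ht
  set w := (S / R * (s / r)) ^ 2 with hw
  have hw0 : 0 ≤ w := by positivity
  have hw1 : w ≤ 1 := by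
    refine pow_le_one₀ (by positivity) (mul_le_one₀ ((div_le_one hR).2 hSR) (by positivity) ?_)
    exact (div_le_one hr).2 hsr
  have key : 1 / (R * R * r) * ((γ + 1) * y * (γ * (S / s ^ 2) * x)) +
      S * ((γ + 1) * y) * ((-2 * γ - 1) * (1 / (R * R * r) * (1 / (R * r) ^ 2)) * (S * S * x))
      = (γ * u - (2 * γ + 1) * (w * u)) * (S / R / s) := by
    rw [hw, hu]; field_simp; ring
  rw [key, abs_mul, abs_of_pos (show 0 < S / R / s by positivity)]
  gcongr
  have hwu : |w * u| ≤ 1 := by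
    rw [abs_mul, abs_of_nonneg hw0]; exact mul_le_one₀ hw1 (abs_nonneg _) hu1
  rw [abs_le] at *
  constructor <;> nlinarith

/-- Bound tz. -/
lemma bound_tz {m k : ℕ} {γ : ℝ} (hγ : 0 < γ) (p : E m k) (hp : p.1 ≠ 0) (i : Fin m)
    (j : Fin k) :
    |Xd γ (Fin.natAdd m j) (Xd γ (Fin.castAdd k i) (rho γ)) p|
      ≤ (4 * (γ + 1) ^ 2) * ((‖p.1‖ ^ γ / rho γ p ^ γ) ^ 3 * ‖p.1‖ / rho γ p ^ 2) := by
  rw [Xd_t, fderiv_Xd_z hγ p hp]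
  have hs : 0 < ‖p.1‖ := norm_pos_iff.mpr hp
  have hr := rho_pos hγ p hp
  have ht := normt_le_rho hγ p hp
  have hi := euclid_coord_le p.1 i
  have hj := euclid_coord_le p.2 j
  simp only [EuclideanSpace.inner_single_right, inner_zero_right, map_one, one_mul, mul_zero,
    add_zero, zero_add, conj_trivial, PiLp.zero_apply]
  set s := ‖p.1‖
  set r := rho γ p
  set x := p.1 i
  set y := p.2 j
  have e0 : s ^ (2 * γ) = s ^ γ * s ^ γ := by rw [← Real.rpow_add hs]; ring_nf
  have e3 : r ^ (-4 * γ - 3) = 1 / (r ^ γ * r ^ γ * r) * (1 / (r ^ γ * r) ^ 2) := by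
    rw [show -4 * γ - 3 = -(γ + γ + 1 + ((γ + 1) + (γ + 1))) by ring, Real.rpow_neg hr.le,
      Real.rpow_add hr, Real.rpow_add hr (γ + 1), Real.rpow_add hr, Real.rpow_add hr,
      Real.rpow_one, Real.rpow_add hr, Real.rpow_one]
    field_simp
  rw [Real.rpow_add hr, Real.rpow_one] at ht
  rw [e0, e3]
  have hS : 0 < s ^ γ := by positivity
  have hR : 0 < r ^ γ := by positivity
  set S := s ^ γ
  set R := r ^ γ
  have hT : 0 < R * r := by positivity
  set u := ((γ + 1) * y / (R * r)) * (x / s) with hu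
  have hg : 0 < γ + 1 := by positivity
  have hu1 : |u| ≤ 1 := by
    rw [hu, abs_mul, abs_div, abs_div, abs_of_pos hT, abs_mul, abs_of_pos hg, abs_of_pos hs]
    refine mul_le_one₀ ((div_le_one hT).2 ?_) (by positivity) ((div_le_one hs).2 hi)
    exact (mul_le_mul_of_nonneg_left hj hg.le).trans ht
  have key : S * S * x * ((-2 * γ - 1) * (1 / (R * R * r) * (1 / (R * r) ^ 2)) *
      ((γ + 1) * (S * y)))
      = (- (2 * γ + 1) * u) * ((S / R) ^ 3 * s / r ^ 2) := by
    rw [hu]; field_simp; ring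
  rw [key, abs_mul, abs_of_pos (show 0 < (S / R) ^ 3 * s / r ^ 2 by positivity)]
  gcongr
  rw [abs_le] at *
  constructor <;> nlinarith

lemma psi_rpow {m k : ℕ} {γ : ℝ} (hγ : 0 < γ) (p : E m k) (hp : p.1 ≠ 0) (β : ℝ) :
    psi γ p ^ β = (‖p.1‖ / rho γ p) ^ (2 * γ * β) := by
  have hr := rho_pos hγ p hp
  rw [psi, ← Real.div_rpow (norm_nonneg _) hr.le, ← Real.rpow_mul (by positivity)]

end BG

open BG in
/-- bounds on second derivatives of the gauge
(Proposition `prop3.4` of the paper). -/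
theorem gauge_second_derivative_bounds
    (m k : ℕ) (hm : 1 ≤ m) (hk : 1 ≤ k) (γ : ℝ) (hγ : 0 < γ) :
    ∃ C > (0 : ℝ), ∀ p : E m k, p.1 ≠ 0 →
      (∀ i j : Fin (m + k),
          ((i : ℕ) < m ∧ (j : ℕ) < m) ∨ (m ≤ (i : ℕ) ∧ m ≤ (j : ℕ)) →
          |Xd γ i (Xd γ j (rho γ)) p| ≤ C * psi γ p / rho γ p) ∧
        (∀ (i : Fin m) (j : Fin k),
          |Xd γ (Fin.castAdd k i) (Xd γ (Fin.natAdd m j) (rho γ)) p|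
              ≤ C * psi γ p ^ ((1 : ℝ) / 2) / ‖p.1‖ ∧
            |Xd γ (Fin.castAdd k i) (Xd γ (Fin.natAdd m j) (rho γ)) p|
              ≤ C * psi γ p ^ ((1 : ℝ) / 2 - 1 / (2 * γ)) / rho γ p) ∧
        ∀ (i : Fin m) (j : Fin k),
          |Xd γ (Fin.natAdd m j) (Xd γ (Fin.castAdd k i) (rho γ)) p|
              ≤ C * psi γ p ^ ((3 : ℝ) / 2) * ‖p.1‖ / rho γ p ^ 2 ∧
            |Xd γ (Fin.natAdd m j) (Xd γ (Fin.castAdd k i) (rho γ)) p|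
              ≤ C * psi γ p ^ ((3 : ℝ) / 2 + 1 / (2 * γ)) / rho γ p := by
  refine ⟨4 * (γ + 1) ^ 2, by positivity, fun p hp => ⟨?_, ?_, ?_⟩⟩
  · intro i j
    refine Fin.addCases (fun i => ?_) (fun i => ?_) i <;>
      refine Fin.addCases (fun j => ?_) (fun j => ?_) j
    · exact fun _ => bound_zz hγ p hp i j
    · intro h; simp at h; omega
    · intro h; simp at h; omega
    · exact fun _ => bound_tt hγ p hp i j
  · intro i j
    have h := bound_zt hγ p hp i j
    have hs : 0 < ‖p.1‖ := norm_pos_iff.mpr hp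
    have hr := rho_pos hγ p hp
    have hx : 0 < ‖p.1‖ / rho γ p := by positivity
    rw [psi_rpow hγ p hp, psi_rpow hγ p hp, show 2 * γ * (1 / 2) = γ by ring,
      show 2 * γ * (1 / 2 - 1 / (2 * γ)) = γ - 1 by field_simp, Real.rpow_sub hx, Real.rpow_one,
      Real.div_rpow hs.le hr.le]
    constructor
    · convert h using 1; ring
    · convert h using 1; field_simp
  · intro i j
    have h := bound_tz hγ p hp i j
    have hs : 0 < ‖p.1‖ := norm_pos_iff.mpr hp
    have hr := rho_pos hγ p hp
    have hx : 0 < ‖p.1‖ / rho γ p := by positivity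
    rw [psi_rpow hγ p hp, psi_rpow hγ p hp, show 2 * γ * (3 / 2) = γ * (3 : ℕ) by push_cast; ring,
      show 2 * γ * (3 / 2 + 1 / (2 * γ)) = γ * (3 : ℕ) + 1 by push_cast; field_simp,
      Real.rpow_add hx, Real.rpow_one, Real.rpow_mul hx.le, Real.rpow_natCast,
      Real.div_rpow hs.le hr.le]
    constructor
    · convert h using 1; ring
    · convert h using 1; field_simp
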